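/- Main theorem: a matrix A ∈ M_n(𝕋) is pseudo invertible if and only if A is tropically regular. -/

import Mathlib

/-- The extended tropical semiring `𝕋 = ℝ ∪ {−∞} ∪ ℝ^ν`:
`neginf` is `−∞`, `real a` is the real (tangible) element `a`,
and `ghost a` is the ghost element `a^ν`. -/
inductive T : Type where
  | neginf : T
  | real : ℝ → T
  | ghost : ℝ → T

namespace T

/-- Tropical addition `⊕` on `𝕋`. -/
noncomputable def add : T → T → T
  | neginf, x => x
  | real a, neginf => real a
  | ghost a, neginf => ghost a
  | real a, real b => if a < b then real b else if b < a then real a else ghost a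
  | real a, ghost b => if a ≤ b then ghost b else real a
  | ghost a, real b => if b ≤ a then ghost a else real b
  | ghost a, ghost b => if a < b then ghost b else ghost a

/-- Tropical multiplication `⊙` on `𝕋`. -/
noncomputable def mul : T → T → T
  | neginf, _ => neginf
  | real _, neginf => neginf
  | ghost _, neginf => neginf
  | real a, real b => real (a + b)
  | real a, ghost b => ghost (a + b)
  | ghost a, real b => ghost (a + b)
  | ghost a, ghost b => ghost (a + b)

/-- The strict order `≺` on `𝕋`. -/
def lt : T → T → Prop
  | neginf, neginf => False
  | neginf, real _ => True
  | neginf, ghost _ => True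
  | real _, neginf => False
  | ghost _, neginf => False
  | real a, real b => a < b
  | real a, ghost b => a ≤ b
  | ghost a, real b => a < b
  | ghost a, ghost b => a < b

/-- The order `⪯` on `𝕋`: `x ⪯ y` iff `x = y` or `x ≺ y`. -/
def le (x y : T) : Prop := x = y ∨ lt x y

/-- Membership in `ℝ̄^ν = ℝ^ν ∪ {−∞}` (the ghost elements together with `−∞`). -/
def isGhost : T → Prop
  | neginf => True
  | real _ => False
  | ghost _ => True

/-- Membership in `ℝ` (the real, tangible elements). -/
def isReal : T → Prop
  | neginf => False
  | real _ => True
  | ghost _ => False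

/-- The ghost map `ν : 𝕋 → ℝ̄^ν`. -/
def nu : T → T
  | neginf => neginf
  | real a => ghost a
  | ghost a => ghost a

/-- The projection `π : 𝕋 → ℝ ∪ {−∞}` onto the max-plus semiring `(ℝ ∪ {−∞}, max, +)`,
realized as `WithBot ℝ`. -/
def pi : T → WithBot ℝ
  | neginf => ⊥
  | real a => (a : WithBot ℝ)
  | ghost a => (a : WithBot ℝ)

/-- The embedding `θ : (ℝ ∪ {−∞}, max, +) → 𝕋`, `a ↦ a^ν`, `−∞ ↦ −∞`. -/
def theta : WithBot ℝ → T :=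
  fun x => WithBot.recBotCoe neginf (fun a => ghost a) x

/-- `pow x n` is the `n`-fold tropical product `x ⊙ x ⊙ ⋯ ⊙ x` (with `pow x 0 = 0`, the one). -/
noncomputable def pow (x : T) : ℕ → T
  | 0 => real 0
  | n + 1 => mul x (pow x n)

instance : Std.Commutative add := ⟨by
  intro x y
  cases x <;> cases y <;> simp only [add] <;> split_ifs <;>
    first | rfl | (exfalso; linarith) | (congr 1; linarith)⟩

instance : Std.Associative add := ⟨by
  intro x y z
  cases x <;> cases y <;> cases z <;>
    simp only [add] <;>
    repeat' (first | split_ifs | simp only [add]) 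
  all_goals first | rfl | (exfalso; linarith) | (congr 1; linarith)⟩

instance : Std.Commutative mul := ⟨by
  intro x y
  cases x <;> cases y <;> simp only [mul] <;> congr 1 <;> ring⟩

instance : Std.Associative mul := ⟨by
  intro x y z
  cases x <;> cases y <;> cases z <;> simp only [mul] <;> congr 1 <;> ring⟩

/-- Finite tropical sum `⊕` over a finite index set. -/
noncomputable def sumT {ι : Type*} (s : Finset ι) (f : ι → T) : T := s.fold add neginf f

/-- Finite tropical product `⊙` over a finite index set. -/
noncomputable def prodT {ι : Type*} (s : Finset ι) (f : ι → T) : T := s.fold mul (real 0) f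

/-- Tropical matrix multiplication over `𝕋`. -/
noncomputable def matMul {n : ℕ} (A B : Matrix (Fin n) (Fin n) T) : Matrix (Fin n) (Fin n) T :=
  fun i j => sumT Finset.univ fun k => mul (A i k) (B k j)

/-- The tropical determinant (permanent) `|A| = ⊕_{σ ∈ S_n} a_{1σ(1)} ⊙ ⋯ ⊙ a_{nσ(n)}`. -/
noncomputable def det {n : ℕ} (A : Matrix (Fin n) (Fin n) T) : T :=
  sumT Finset.univ fun σ : Equiv.Perm (Fin n) => prodT Finset.univ fun i => A i (σ i)

/-- `A` is tropically regular if `|A| ∈ ℝ`. -/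
def regular {n : ℕ} (A : Matrix (Fin n) (Fin n) T) : Prop := isReal (det A)

/-- `A` is tropically singular if `|A| ∈ ℝ̄^ν`. -/
def singular {n : ℕ} (A : Matrix (Fin n) (Fin n) T) : Prop := isGhost (det A)

/-- The minor `A_{ij}`: delete row `i` and column `j`. -/
noncomputable def minor {n : ℕ} (A : Matrix (Fin (n+1)) (Fin (n+1)) T) (i j : Fin (n+1)) :
    Matrix (Fin n) (Fin n) T :=
  A.submatrix i.succAbove j.succAbove

/-- The adjoint matrix `Adj(A)`, the transpose of the matrix of minors' determinants. -/
noncomputable def adj {n : ℕ} (A : Matrix (Fin (n+1)) (Fin (n+1)) T) :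
    Matrix (Fin (n+1)) (Fin (n+1)) T :=
  fun i j => det (minor A j i)

/-- The `⊙`-inverse `x^{-1}` (only meaningful away from `−∞`): `a ↦ −a`, `a^ν ↦ (−a)^ν`. -/
def dinv : T → T
  | neginf => neginf
  | real a => real (-a)
  | ghost a => ghost (-a)

/-- The pseudo inverse `A^∇ = Adj(A) ⊙ |A|^{-1}`. -/
noncomputable def pinv {n : ℕ} (A : Matrix (Fin (n+1)) (Fin (n+1)) T) :
    Matrix (Fin (n+1)) (Fin (n+1)) T :=
  fun i j => mul (adj A i j) (dinv (det A))

/-- A pseudo unit matrix: tropically regular, `0` on the diagonal,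
and ghosts (or `−∞`) off the diagonal. -/
def pseudoUnit {n : ℕ} (E : Matrix (Fin n) (Fin n) T) : Prop :=
  regular E ∧ (∀ i, E i i = real 0) ∧ ∀ i j, i ≠ j → isGhost (E i j)

/-- `A` is pseudo invertible if `A ⊙ B` and `B ⊙ A` are pseudo units for some `B`. -/
def pseudoInvertible {n : ℕ} (A : Matrix (Fin n) (Fin n) T) : Prop :=
  ∃ B, pseudoUnit (matMul A B) ∧ pseudoUnit (matMul B A)

/-- The ray/point `P_x ⊆ ℝ ∪ {−∞}` assigned to `x ∈ 𝕋`: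
`P_{−∞} = {−∞}`, `P_a = {a}`, `P_{a^ν} = [−∞, a]`. -/
def P : T → Set (WithBot ℝ)
  | neginf => {⊥}
  | real a => {(a : WithBot ℝ)}
  | ghost a => {t | t ≤ (a : WithBot ℝ)}

end T

open Finset in
/-- If every permutation has nonpositive total weight, then so does every closed walk, written as
a cyclic reindexing `x ∘ c` of a family of vertices `x`. -/
theorem sum_closedWalk_nonpos {ι S : Type*} [Fintype ι] [DecidableEq ι] [Fintype S]
    {d : ι → ι → ℝ} (hdiag : ∀ i, d i i = 0) (hd : ∀ σ : Equiv.Perm ι, ∑ i, d i (σ i) ≤ 0)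
    (x : S → ι) (c : Equiv.Perm S) : ∑ s, d (x s) (x (c s)) ≤ 0 := by
  rcases isEmpty_or_nonempty S with hS | hS
  · simp
  have hcard : (0 : ℝ) < Fintype.card S := by exact_mod_cast Fintype.card_pos
  let E : Matrix ι ι ℝ := fun i j => ∑ s,
    ((if x s = i then if x (c s) = j then 1 else 0 else 0) +
      (if i = j then if x s = i then 0 else 1 else 0))
  let M : Matrix ι ι ℝ := fun i j => (Fintype.card S : ℝ)⁻¹ * E i j
  have hM : M ∈ doublyStochastic ℝ ι := by
    rw [mem_doublyStochastic_iff_sum]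
    refine ⟨fun i j => ?_, fun i => ?_, fun j => ?_⟩
    · refine mul_nonneg (inv_nonneg.2 hcard.le) (sum_nonneg fun s _ => ?_)
      split_ifs <;> norm_num
    · simp only [M, E, ← mul_sum]
      rw [sum_comm, inv_mul_eq_one₀ hcard.ne', Fintype.card, cast_card]
      refine sum_congr rfl fun s _ => ?_
      by_cases h : x s = i <;> simp [h]
    · simp only [M, E, ← mul_sum]
      rw [sum_comm, inv_mul_eq_one₀ hcard.ne', Fintype.card, cast_card]
      simp only [sum_add_distrib, sum_ite_eq, sum_ite_eq', mem_univ, if_true]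
      rw [Equiv.sum_comp c (fun s => if x s = j then (1 : ℝ) else 0), ← sum_add_distrib]
      refine sum_congr rfl fun s _ => ?_
      by_cases h : x s = j <;> simp [h]
  obtain ⟨w, hw, -, hwM⟩ := exists_eq_sum_perm_of_mem_doublyStochastic hM
  have h₁ : ∑ i, ∑ j, M i j * d i j ≤ 0 := by
    have : ∑ i, ∑ j, M i j * d i j = ∑ σ, w σ * ∑ i, d i (σ i) := by
      simp only [← hwM, Matrix.sum_apply, Matrix.smul_apply, smul_eq_mul, sum_mul, mul_sum]
      rw [sum_congr rfl fun i _ => sum_comm, sum_comm]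
      simp [PEquiv.toMatrix_apply, Equiv.toPEquiv_apply]
    rw [this]
    exact sum_nonpos fun σ _ => mul_nonpos_of_nonneg_of_nonpos (hw σ) (hd σ)
  have h₂ : ∑ i, ∑ j, M i j * d i j = (Fintype.card S : ℝ)⁻¹ * ∑ s, d (x s) (x (c s)) := by
    simp only [M, E, mul_assoc, ← mul_sum, sum_mul]
    congr 1
    rw [sum_congr rfl fun i _ => sum_comm, sum_comm]
    refine sum_congr rfl fun s _ => ?_
    simp [add_mul, sum_add_distrib, ite_mul, hdiag]
  rw [h₂] at h₁
  exact nonpos_of_mul_nonpos_right h₁ (inv_pos.2 hcard)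

open Finset in
/-- A weight matrix with zero diagonal in which no permutation has positive total weight is
dominated by the differences of a potential. -/
theorem exists_potential {ι : Type*} [Fintype ι] [DecidableEq ι]
    {d : ι → ι → ℝ} (hdiag : ∀ i, d i i = 0) (hd : ∀ σ : Equiv.Perm ι, ∑ i, d i (σ i) ≤ 0) :
    ∃ p : ι → ℝ, ∀ i j, d i j ≤ p i - p j := by
  let W : ι → Set ℝ := fun i =>
    {r | ∃ (m : ℕ) (x : ℕ → ι), x 0 = i ∧ r = ∑ t ∈ range m, d (x t) (x (t + 1))}
  have hne : ∀ i, (W i).Nonempty := fun i => ⟨0, 0, fun _ => i, rfl, by simp⟩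
  have hbdd : ∀ i, BddAbove (W i) := by
    refine fun i => ⟨∑ k, |d k i|, ?_⟩
    rintro _ ⟨m, x, rfl, rfl⟩
    have h := sum_closedWalk_nonpos hdiag hd (fun t : Fin (m + 1) => x t) (finRotate (m + 1))
    rw [Fin.sum_univ_castSucc] at h
    have h' : ∑ t : Fin m, d (x (t.castSucc : Fin (m + 1))) (x (finRotate (m + 1) t.castSucc)) =
        ∑ t ∈ range m, d (x t) (x (t + 1)) := by
      rw [← Fin.sum_univ_eq_sum_range (fun t => d (x t) (x (t + 1)))]
      refine sum_congr rfl fun t _ => ?_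
      have := finRotate_of_lt t.2
      rw [show t.castSucc = ⟨t, t.2.trans_le m.le_succ⟩ from rfl, this]
    rw [h', finRotate_last] at h
    have h₁ : |d (x m) (x 0)| ≤ ∑ k, |d k (x 0)| :=
      single_le_sum (f := fun k => |d k (x 0)|) (fun k _ => abs_nonneg _) (mem_univ _)
    have h₂ := neg_abs_le (d (x m) (x 0))
    simp only [Fin.val_last, Fin.val_zero] at h
    linarith
  refine ⟨fun i => sSup (W i), fun i j => ?_⟩
  rw [le_sub_iff_add_le, ← le_sub_iff_add_le']
  refine csSup_le (hne j) ?_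
  rintro _ ⟨m, x, rfl, rfl⟩
  rw [le_sub_iff_add_le']
  refine le_csSup (hbdd i) ⟨m + 1, fun t => Nat.casesOn t i x, rfl, ?_⟩
  rw [sum_range_succ', add_comm]
  rfl

open Finset in
/-- If the permutation `τ` is the unique one of maximal total weight, then there are dual variables
`u`, `v` that are tight along `τ` and have a uniform slack off `τ`. -/
theorem exists_strict_dual {ι : Type*} [Fintype ι] [DecidableEq ι]
    {w : ι → ι → ℝ} {τ : Equiv.Perm ι}
    (h : ∀ σ : Equiv.Perm ι, σ ≠ τ → ∑ i, w i (σ i) < ∑ i, w i (τ i)) :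
    ∃ (u v : ι → ℝ) (δ : ℝ), 0 < δ ∧ (∀ i, w i (τ i) = u i + v (τ i)) ∧
      ∀ i j, j ≠ τ i → w i j ≤ u i + v j - δ := by
  let d : ι → ι → ℝ := fun i j => w i (τ j) - w j (τ j)
  have hd : ∀ σ : Equiv.Perm ι, σ ≠ 1 → ∑ i, d i (σ i) < 0 := by
    intro σ hσ
    have h₁ := h (τ * σ) (by simpa using hσ)
    have h₂ := Equiv.sum_comp σ (fun i => w i (τ i))
    simp only [d, sum_sub_distrib, h₂]
    simpa using h₁
  obtain ⟨ε, hε, hdε⟩ : ∃ ε > 0, ∀ σ : Equiv.Perm ι, σ ≠ 1 →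
      ∑ i, d i (σ i) + Fintype.card ι * ε < 0 := by
    have : ∀ᶠ ε in nhdsWithin (0 : ℝ) (Set.Ioi 0), ∀ σ : Equiv.Perm ι, σ ≠ 1 →
        ∑ i, d i (σ i) + Fintype.card ι * ε < 0 := by
      refine Filter.eventually_all.2 fun σ => ?_
      by_cases hσ : σ = 1
      · simp [hσ]
      have hc : ContinuousAt (fun ε : ℝ => ∑ i, d i (σ i) + Fintype.card ι * ε) 0 := by fun_prop
      filter_upwards [nhdsWithin_le_nhds (hc.eventually_lt (g := fun _ => (0 : ℝ))
        continuousAt_const (by simpa using hd σ hσ))]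
        with ε hε _ using hε
    obtain ⟨ε, h₁, h₂⟩ := (this.and self_mem_nhdsWithin).exists
    exact ⟨ε, h₂, h₁⟩
  obtain ⟨p, hp⟩ := exists_potential (d := fun i j => d i j + if i = j then 0 else ε)
    (fun i => by simp [d]) (fun σ => by
      by_cases hσ : σ = 1
      · simp [hσ, d]
      · have : ∑ i, (if i = σ i then 0 else ε) ≤ ∑ _i : ι, ε :=
          sum_le_sum fun i _ => by split_ifs <;> linarith
        simp only [sum_const, card_univ, nsmul_eq_mul] at this
        have := hdε σ hσ
        rw [sum_add_distrib]
        linarith)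
  refine ⟨p, fun k => w (τ.symm k) k - p (τ.symm k), ε, hε, fun i => by simp, fun i j hij => ?_⟩
  obtain ⟨k, rfl⟩ := τ.surjective j
  have h₁ := hp i k
  rw [if_neg (by rintro rfl; exact hij rfl)] at h₁
  simp only [d, Equiv.symm_apply_apply] at h₁ ⊢
  linarith

namespace T

@[simp] theorem pi_add (x y : T) : (add x y).pi = max x.pi y.pi := by
  symm
  cases x <;> cases y <;> simp only [add] <;> (try split_ifs) <;>
    first
    | exact max_eq_left (WithBot.coe_le_coe.2 (by linarith))
    | exact max_eq_right (WithBot.coe_le_coe.2 (by linarith))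
    | exact max_eq_left bot_le
    | exact max_eq_right bot_le

@[simp] theorem pi_mul (x y : T) : (mul x y).pi = x.pi + y.pi := by
  cases x <;> cases y <;> simp [mul, pi]

theorem add_real_of_lt {a : ℝ} {y : T} (h : y.pi < a) : add (real a) y = real a := by
  cases y <;> simp_all [add, pi]
  grind

theorem add_ghost_of_le {a : ℝ} {y : T} (h : y.pi ≤ a) : add (ghost a) y = ghost a := by
  cases y <;> simp_all [add, pi]

theorem real_of_add_eq_real {a : ℝ} {x y : T} (h : add x y = real a) :
    (x = real a ∧ y.pi < a) ∨ (y = real a ∧ x.pi < a) := by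
  cases x <;> cases y <;> simp only [add] at h <;> (try split_ifs at h) <;> simp_all [pi]

theorem mul_add_distrib (x y z : T) : mul x (add y z) = add (mul x y) (mul x z) := by
  cases x <;> cases y <;> cases z <;> simp only [add, mul] <;>
    repeat' (first | split_ifs | simp only)
  all_goals first | rfl | (exfalso; linarith) | (congr 1; linarith)

/-- The tropical semiring structure on `𝕋`. -/
noncomputable instance : CommSemiring T where
  add := add
  mul := mul
  zero := neginf
  one := real 0
  nsmul := @nsmulRec T ⟨neginf⟩ ⟨add⟩
  add_assoc := Std.Associative.assoc (op := add)
  add_comm := Std.Commutative.comm (op := add)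
  mul_assoc := Std.Associative.assoc (op := mul)
  mul_comm := Std.Commutative.comm (op := mul)
  zero_add _ := rfl
  add_zero x := by cases x <;> rfl
  zero_mul _ := rfl
  mul_zero x := by cases x <;> rfl
  one_mul x := by
    change mul (real 0) x = x
    cases x <;> simp [mul]
  mul_one x := by
    change mul x (real 0) = x
    cases x <;> simp [mul]
  left_distrib := mul_add_distrib
  right_distrib x y z := by
    change mul (add x y) z = add (mul x z) (mul y z)
    simp only [Std.Commutative.comm (op := mul) _ z, mul_add_distrib]

theorem sumT_eq_sum {ι : Type*} (s : Finset ι) (f : ι → T) : sumT s f = ∑ i ∈ s, f i := rfl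

theorem prodT_eq_prod {ι : Type*} (s : Finset ι) (f : ι → T) : prodT s f = ∏ i ∈ s, f i := rfl

theorem pi_prod {ι : Type*} (s : Finset ι) (f : ι → T) : (∏ i ∈ s, f i).pi = ∑ i ∈ s, (f i).pi := by
  classical
  induction s using Finset.induction with
  | empty => rfl
  | insert a s ha ih =>
    rw [Finset.prod_insert ha, Finset.sum_insert ha, ← ih]
    exact pi_mul _ _

theorem pi_sum {ι : Type*} (s : Finset ι) (f : ι → T) :
    (∑ i ∈ s, f i).pi = s.sup fun i => (f i).pi := by
  classical
  induction s using Finset.induction with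
  | empty => rfl
  | insert a s ha ih =>
    rw [Finset.sum_insert ha, Finset.sup_insert, ← ih]
    exact pi_add _ _

theorem exists_of_sum_eq_real {ι : Type*} {s : Finset ι} {f : ι → T} {a : ℝ}
    (h : ∑ i ∈ s, f i = real a) :
    ∃ t ∈ s, f t = real a ∧ ∀ u ∈ s, u ≠ t → (f u).pi < a := by
  classical
  induction s using Finset.induction with
  | empty => exact T.noConfusion h
  | insert b s hb ih =>
    rw [Finset.sum_insert hb] at h
    obtain ⟨h₁, h₂⟩ | ⟨h₁, h₂⟩ := real_of_add_eq_real h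
    · rw [pi_sum, Finset.sup_lt_iff (WithBot.bot_lt_coe a)] at h₂
      refine ⟨b, Finset.mem_insert_self b s, h₁, fun u hu hub => h₂ u ?_⟩
      exact Finset.mem_of_mem_insert_of_ne hu hub
    · obtain ⟨t, ht, hta, hlt⟩ := ih h₁
      refine ⟨t, Finset.mem_insert_of_mem ht, hta, fun u hu hut => ?_⟩
      obtain rfl | hu := Finset.mem_insert.1 hu
      exacts [h₂, hlt u hu hut]

theorem sum_eq_real {ι : Type*} {s : Finset ι} {f : ι → T} {a : ℝ} {t : ι} (ht : t ∈ s)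
    (hta : f t = real a) (h : ∀ u ∈ s, u ≠ t → (f u).pi < a) : ∑ i ∈ s, f i = real a := by
  classical
  rw [← Finset.add_sum_erase s f ht, hta]
  refine add_real_of_lt ?_
  rw [pi_sum, Finset.sup_lt_iff (WithBot.bot_lt_coe a)]
  exact fun u hu => h u (Finset.mem_of_mem_erase hu) (Finset.ne_of_mem_erase hu)

theorem sum_eq_ghost {ι : Type*} {s : Finset ι} {f : ι → T} {a : ℝ} {t : ι} (ht : t ∈ s)
    (hta : f t = ghost a) (h : ∀ u ∈ s, (f u).pi ≤ a) : ∑ i ∈ s, f i = ghost a := by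
  classical
  rw [← Finset.add_sum_erase s f ht, hta]
  refine add_ghost_of_le ?_
  rw [pi_sum]
  exact Finset.sup_le fun u hu => h u (Finset.mem_of_mem_erase hu)

theorem isReal_iff {x : T} : x.isReal ↔ ∃ a, x = real a := by
  cases x <;> simp [isReal]

theorem isReal_mul {x y : T} : (x * y).isReal ↔ x.isReal ∧ y.isReal := by
  change (mul x y).isReal ↔ _
  cases x <;> cases y <;> simp [isReal, mul]

theorem isReal_prod {ι : Type*} {s : Finset ι} {f : ι → T} :
    (∏ i ∈ s, f i).isReal ↔ ∀ i ∈ s, (f i).isReal := by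
  classical
  induction s using Finset.induction with
  | empty => exact ⟨fun _ => by simp, fun _ => trivial⟩
  | insert b s hb ih => rw [Finset.prod_insert hb, isReal_mul, ih, Finset.forall_mem_insert]

theorem regular_of_regular_matMul {n : ℕ} {A B : Matrix (Fin n) (Fin n) T}
    (h : regular (matMul A B)) : regular A := by
  obtain ⟨a, ha⟩ := isReal_iff.1 h
  let F : Equiv.Perm (Fin n) × (Fin n → Fin n) → T := fun q =>
    (∏ i, A i (q.2 i)) * ∏ i, B (q.2 i) (q.1 i)
  have hdet : det (matMul A B) = ∑ q, F q := by
    simp only [det, matMul, sumT_eq_sum, prodT_eq_prod]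
    rw [Fintype.sum_prod_type]
    refine Finset.sum_congr rfl fun σ _ => ?_
    exact (Finset.prod_univ_sum _ _).trans
      (Finset.sum_congr (by simp) fun f _ => Finset.prod_mul_distrib)
  obtain ⟨⟨σ, f⟩, -, hq, hlt⟩ := exists_of_sum_eq_real (hdet.symm.trans ha)
  have hqpi : (F (σ, f)).pi = a := by rw [hq]; rfl
  have hf : Function.Injective f := by
    intro i j hij
    by_contra hne
    have hσ : σ * Equiv.swap i j ≠ σ := by simpa [Equiv.swap_eq_one_iff] using hne
    have h₁ := hlt (σ * Equiv.swap i j, f) (Finset.mem_univ _) fun h => hσ (congrArg Prod.fst h)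
    have h₂ : F (σ * Equiv.swap i j, f) = F (σ, f) := by
      simp only [F]
      congr 1
      rw [← Equiv.prod_comp (Equiv.swap i j) fun k => B (f k) (σ k)]
      refine Finset.prod_congr rfl fun k _ => ?_
      congr 1
      by_cases hi : k = i
      · simp [hi, hij]
      by_cases hj : k = j
      · simp [hj, hij]
      rw [Equiv.swap_apply_of_ne_of_ne hi hj]
    rw [h₂, hqpi] at h₁
    exact h₁.ne rfl
  obtain ⟨ρ, rfl⟩ : ∃ ρ : Equiv.Perm (Fin n), ⇑ρ = f :=
    ⟨Equiv.ofBijective f (Finite.injective_iff_bijective.1 hf), rfl⟩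
  obtain ⟨hA, hB⟩ := isReal_mul.1 (isReal_iff.2 ⟨a, hq⟩)
  obtain ⟨b, hb⟩ := isReal_iff.1 hA
  obtain ⟨c, hc⟩ := isReal_iff.1 hB
  refine isReal_iff.2 ⟨b, sum_eq_real (Finset.mem_univ ρ) hb fun ρ' _ hρ' => ?_⟩
  have h₁ := hlt (σ * ρ⁻¹ * ρ', ρ') (Finset.mem_univ _)
    fun h => hρ' (Equiv.coe_fn_injective (congrArg Prod.snd h))
  have h₂ : ∏ i, B (ρ' i) ((σ * ρ⁻¹ * ρ') i) = real c := by
    have hc' : ∏ i, B (ρ i) (σ i) = real c := hc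
    rw [← hc', ← Equiv.prod_comp (ρ⁻¹ * ρ') fun i => B (ρ i) (σ i)]
    simp
  have hpi (x y : T) : (x * y).pi = x.pi + y.pi := pi_mul x y
  simp only [F] at h₁ hqpi hc hb
  rw [← hqpi, hpi, hpi, h₂, hc, hb] at h₁
  exact lt_of_add_lt_add_right h₁

theorem pseudoUnit_of_potential {n : ℕ} {E : Matrix (Fin n) (Fin n) T} {q : Fin n → ℝ} {δ : ℝ}
    (hδ : 0 < δ) (hdiag : ∀ i, E i i = real 0)
    (hoff : ∀ i j, i ≠ j → E i j = ghost (q i - q j - δ)) : pseudoUnit E := by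
  refine ⟨isReal_iff.2 ⟨0, sum_eq_real (Finset.mem_univ 1) ?_ fun σ _ hσ => ?_⟩, hdiag,
    fun i j hij => by rw [hoff i j hij]; trivial⟩
  · simp only [Equiv.Perm.one_apply, hdiag]
    exact Finset.prod_const_one
  · have h : ∀ i, (E i (σ i)).pi =
        ((q i - q (σ i) - if i = σ i then 0 else δ : ℝ) : WithBot ℝ) := by
      intro i
      split_ifs with hi
      · rw [← hi, hdiag]
        simp [pi]
      · rw [hoff i _ hi]
        rfl
    rw [prodT_eq_prod, pi_prod, Finset.sum_congr rfl fun i _ => h i, ← WithBot.coe_sum,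
      WithBot.coe_lt_coe, Finset.sum_sub_distrib, Finset.sum_sub_distrib, Equiv.sum_comp σ q,
      sub_self, zero_sub, neg_lt_zero]
    obtain ⟨i, hi⟩ := not_forall.1 fun h => hσ (Equiv.ext h)
    refine Finset.sum_pos' (fun i _ => ?_) ⟨i, Finset.mem_univ i, ?_⟩
    · split_ifs
      exacts [le_rfl, hδ.le]
    · rwa [if_neg fun h => hi h.symm]

theorem exists_strict_dual_of_regular {n : ℕ} {A : Matrix (Fin n) (Fin n) T} (hA : regular A) :
    ∃ (τ : Equiv.Perm (Fin n)) (u v : Fin n → ℝ) (δ : ℝ), 0 < δ ∧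
      (∀ i, A i (τ i) = real (u i + v (τ i))) ∧
      ∀ i j, j ≠ τ i → (A i j).pi ≤ (u i + v j - δ : ℝ) := by
  obtain ⟨a, ha⟩ := isReal_iff.1 hA
  obtain ⟨τ, -, hτ, hlt⟩ := exists_of_sum_eq_real ha
  rw [prodT_eq_prod] at hτ
  have hreal := isReal_prod.1 (isReal_iff.2 ⟨a, hτ⟩)
  let z : Fin n → Fin n → ℝ := fun i j => (A i j).pi.unbotD 0
  let K : ℝ := ∑ i, ∑ j, |z i j|
  have hK : ∀ σ : Equiv.Perm (Fin n), |∑ i, z i (σ i)| ≤ K := fun σ =>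
    (Finset.abs_sum_le_sum_abs _ _).trans <| Finset.sum_le_sum fun i _ =>
      Finset.single_le_sum (f := fun j => |z i j|) (fun _ _ => abs_nonneg _) (Finset.mem_univ _)
  have hK₀ : 0 ≤ K := (abs_nonneg _).trans (hK 1)
  let w : Fin n → Fin n → ℝ := fun i j => z i j - if (A i j).pi = ⊥ then 2 * K + 1 else 0
  have hw : ∀ i j, (A i j).pi ≠ ⊥ → ((w i j : ℝ) : WithBot ℝ) = (A i j).pi := by
    intro i j h
    obtain ⟨x, hx⟩ := WithBot.ne_bot_iff_exists.1 h
    simp [w, z, ← hx]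
  have hwle : ∀ i j, (A i j).pi ≤ (w i j : ℝ) := by
    intro i j
    by_cases h : (A i j).pi = ⊥
    · simp [h]
    · exact (hw i j h).ge
  have hwτ : ∀ i, A i (τ i) = real (w i (τ i)) := by
    intro i
    obtain ⟨x, hx⟩ := isReal_iff.1 (hreal i (Finset.mem_univ i))
    simp [w, z, hx, pi]
  have hwz : ∑ i, w i (τ i) = ∑ i, z i (τ i) := by
    refine Finset.sum_congr rfl fun i _ => ?_
    obtain ⟨x, hx⟩ := isReal_iff.1 (hreal i (Finset.mem_univ i))
    simp [w, hx, pi]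
  have hwa : ∑ i, w i (τ i) = a := by
    have := congrArg pi hτ
    rw [pi_prod, Finset.sum_congr rfl fun i _ => congrArg pi (hwτ i)] at this
    simp only [pi] at this
    exact_mod_cast this
  have hmax : ∀ σ : Equiv.Perm (Fin n), σ ≠ τ → ∑ i, w i (σ i) < ∑ i, w i (τ i) := by
    intro σ hσ
    by_cases hbot : ∃ i, (A i (σ i)).pi = ⊥
    · obtain ⟨i, hi⟩ := hbot
      have h₁ : 2 * K + 1 ≤ ∑ i, if (A i (σ i)).pi = ⊥ then 2 * K + 1 else 0 := by
        have := Finset.single_le_sum (f := fun i => if (A i (σ i)).pi = ⊥ then 2 * K + 1 else 0)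
          (fun i _ => ite_nonneg (by linarith) le_rfl) (Finset.mem_univ i)
        rwa [if_pos hi] at this
      rw [hwz]
      simp only [w, Finset.sum_sub_distrib]
      have h₂ := le_abs_self (∑ i, z i (σ i))
      have h₃ := neg_abs_le (∑ i, z i (τ i))
      linarith [hK σ, hK τ]
    · push Not at hbot
      have h₁ := hlt σ (Finset.mem_univ σ) hσ
      rw [prodT_eq_prod, pi_prod, Finset.sum_congr rfl fun i _ => (hw _ _ (hbot i)).symm] at h₁
      rw [hwa]
      exact_mod_cast h₁
  obtain ⟨u, v, δ, hδ, heq, hle⟩ := exists_strict_dual hmax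
  exact ⟨τ, u, v, δ, hδ, fun i => by rw [hwτ, heq],
    fun i j hij => (hwle i j).trans (WithBot.coe_le_coe.2 (hle i j hij))⟩

theorem pi_mul_le {x y : T} {a b c : ℝ} (hx : x.pi ≤ a) (hy : y.pi ≤ b) (h : a + b ≤ c) :
    (mul x y).pi ≤ c := by
  rw [pi_mul]
  exact (add_le_add hx hy).trans (by exact_mod_cast h)

theorem pseudoInvertible_of_regular {n : ℕ} {A : Matrix (Fin n) (Fin n) T} (hA : regular A) :
    pseudoInvertible A := by
  obtain ⟨τ, u, v, δ, hδ, heq, hle⟩ := exists_strict_dual_of_regular hA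
  let B : Matrix (Fin n) (Fin n) T := fun k i =>
    if k = τ i then real (-u i - v k) else ghost (-u i - v k - δ)
  have hBτ : ∀ i, B (τ i) i = real (-u i - v (τ i)) := fun i => if_pos rfl
  have hBne : ∀ k i, k ≠ τ i → B k i = ghost (-u i - v k - δ) := fun k i h => if_neg h
  have hAle : ∀ i k, (A i k).pi ≤ (u i + v k : ℝ) := by
    intro i k
    by_cases h : k = τ i
    · rw [h, heq]
      exact le_rfl
    · exact (hle i k h).trans (WithBot.coe_le_coe.2 (by linarith))
  have hBle : ∀ k i, (B k i).pi ≤ (-u i - v k : ℝ) := by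
    intro k i
    by_cases h : k = τ i
    · rw [h, hBτ]
      exact le_rfl
    · rw [hBne k i h]
      exact WithBot.coe_le_coe.2 (by linarith)
  have hBle' : ∀ k i, k ≠ τ i → (B k i).pi ≤ (-u i - v k - δ : ℝ) := fun k i h => by
    rw [hBne k i h]
    exact le_rfl
  have hneg : ((-δ : ℝ) : WithBot ℝ) < (0 : ℝ) := WithBot.coe_lt_coe.2 (by linarith)
  refine ⟨B, pseudoUnit_of_potential (q := u) hδ (fun i => ?_) fun i j hij => ?_,
    pseudoUnit_of_potential (q := fun k => -v k) hδ (fun k => ?_) fun k l hkl => ?_⟩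
  · refine sum_eq_real (Finset.mem_univ (τ i)) ?_ fun k _ hk => ?_
    · rw [heq, hBτ, mul]
      congr 1
      ring
    · exact (pi_mul_le (hAle i k) (hBle' k i hk) (by linarith)).trans_lt hneg
  · have hτ : τ i ≠ τ j := fun h => hij (τ.injective h)
    refine sum_eq_ghost (Finset.mem_univ (τ i)) ?_ fun k _ => ?_
    · rw [heq, hBne _ _ hτ, mul]
      congr 1
      ring
    · by_cases hk : k = τ j
      · exact pi_mul_le (hle i k (hk.trans_ne hτ.symm)) (hBle k j) (by linarith)
      · exact pi_mul_le (hAle i k) (hBle' k j hk) (by linarith)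
  · obtain ⟨i, rfl⟩ := τ.surjective k
    refine sum_eq_real (Finset.mem_univ i) ?_ fun j _ hj => ?_
    · rw [heq, hBτ, mul]
      congr 1
      ring
    · have hτ : τ i ≠ τ j := fun h => hj (τ.injective h).symm
      exact (pi_mul_le (hBle' _ j hτ) (hAle j _) (by linarith)).trans_lt hneg
  · obtain ⟨j, rfl⟩ := τ.surjective l
    refine sum_eq_ghost (Finset.mem_univ j) ?_ fun i _ => ?_
    · rw [heq, hBne _ _ hkl, mul]
      congr 1
      ring
    · by_cases hk : k = τ i
      · exact pi_mul_le (hBle k i) (hle i _ (fun h => hkl (hk.trans h.symm))) (by linarith)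
      · exact pi_mul_le (hBle' k i hk) (hAle i _) (by linarith)

end T

/-- main theorem: a matrix `A ∈ M_n(𝕋)` is pseudo invertible
if and only if it is tropically regular. -/
theorem pseudoInvertible_iff_regular {n : ℕ} (A : Matrix (Fin n) (Fin n) T) :
    T.pseudoInvertible A ↔ T.regular A := by
  exact ⟨fun ⟨_, h, _⟩ => T.regular_of_regular_matMul h.1, T.pseudoInvertible_of_regular⟩
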